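/- Let F be a field of characteristic 2 and let ψ₁ be an (m+k)-fold and ψ₂ an (n+k)-fold quadratic Pfister form over F that are separably k-linked. If ψ₁ and ψ₂ are also inseparably k-linked, then their k-invariant F_k(ψ₁, ψ₂) is hyperbolic. -/

import Mathlib

noncomputable section

open QuadraticMap

/-- A quadratic form over `F` on the space `F^d`, bundled together with its dimension `d`. -/
structure QF (F : Type) [Field F] where
  dim : ℕ
  form : QuadraticForm F (Fin dim → F)

namespace QF

variable {F : Type} [Field F]

/-- Isometry of bundled quadratic forms. -/
def Equiv (q q' : QF F) : Prop := QuadraticMap.Equivalent q.form q'.form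

/-- The standard linear equivalence `F^(a+b) ≃ F^a × F^b`. -/
def finSplit (F : Type) [Field F] (a b : ℕ) :
    (Fin (a + b) → F) ≃ₗ[F] (Fin a → F) × (Fin b → F) :=
  (LinearEquiv.funCongrLeft F F finSumFinEquiv).trans
    (LinearEquiv.sumArrowLequivProdArrow _ _ F F)

/-- Orthogonal sum of bundled quadratic forms. -/
def sum (q₁ q₂ : QF F) : QF F :=
  ⟨q₁.dim + q₂.dim, (q₁.form.prod q₂.form).comp (finSplit F q₁.dim q₂.dim).toLinearMap⟩

instance : Neg (QF F) := ⟨fun q => ⟨q.dim, -q.form⟩⟩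

instance : SMul F (QF F) := ⟨fun a q => ⟨q.dim, a • q.form⟩⟩

/-- `⟨⟨γ⟩⟩ ⊗ q = q ⊥ (−γ)·q` : twisting a quadratic form by the
1-fold bilinear Pfister form `⟨⟨γ⟩⟩ = ⟨1, −γ⟩`. -/
def twist (γ : F) (q : QF F) : QF F := q.sum ((-γ) • q)

/-- `⟨⟨γ₁,…,γ_m⟩⟩ ⊗ q` : tensoring a quadratic form with the `m`-fold bilinear
Pfister form whose slots are the entries of the list `l = [γ₁,…,γ_m]`. -/
def btensor (l : List F) (q : QF F) : QF F := l.foldr twist q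

/-- The zero form on the zero space. -/
def zero (F : Type) [Field F] : QF F := ⟨0, 0⟩

/-- The one-dimensional form `⟨1⟩`, `x ↦ x²`. -/
def unit (F : Type) [Field F] : QF F := ⟨1, QuadraticMap.sq.comp (LinearMap.proj 0)⟩

/-- The binary quadratic form `[1,α] : (x,y) ↦ x² + xy + αy²`. -/
def binary (α : F) : QF F := ⟨2, (Matrix.of ![![1, 1], ![0, α]]).toQuadraticMap'⟩

/-- The hyperbolic plane `ℍ : (x,y) ↦ xy`. -/
def hyp (F : Type) [Field F] : QF F := ⟨2, (Matrix.of ![![0, 1], ![0, 0]]).toQuadraticMap'⟩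

/-- `m × ℍ`, the orthogonal sum of `m` hyperbolic planes. -/
def hyps (F : Type) [Field F] : ℕ → QF F
  | 0 => zero F
  | n + 1 => (hyp F).sum (hyps F n)

/-- A quadratic form is isotropic if it represents `0` nontrivially. -/
def Isotropic (q : QF F) : Prop := ∃ v, q.form v = 0 ∧ v ≠ 0

/-- A quadratic form is hyperbolic if it is isometric to an orthogonal
sum of hyperbolic planes. -/
def Hyperbolic (q : QF F) : Prop := ∃ m, q.Equiv (hyps F m)

/-- All entries of the list are nonzero (the slots of a bilinear Pfister form
must be units). -/
def UnitList (l : List F) : Prop := ∀ γ ∈ l, γ ≠ 0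

/-- `q` is an `n`-fold quadratic Pfister form.  In characteristic `2` this means
`q ≅ ⟨⟨γ₁,…,γ_{n−1}, α]] = ⟨⟨γ₁,…,γ_{n−1}⟩⟩ ⊗ [1,α]`; in characteristic `≠ 2` it means
`q ≅ ⟨⟨γ₁,…,γ_n⟩⟩ = ⟨1,−γ₁⟩ ⊗ ⋯ ⊗ ⟨1,−γ_n⟩`. -/
def IsQPfister (n : ℕ) (q : QF F) : Prop :=
  if ringChar F = 2 then
    ∃ (l : List F) (α : F), UnitList l ∧ l.length + 1 = n ∧ (btensor l (binary α)).Equiv q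
  else
    ∃ l : List F, UnitList l ∧ l.length = n ∧ (btensor l (unit F)).Equiv q

/-- `φ` is a `k`-fold quadratic Pfister factor of `ψ`, i.e. `ψ ≅ B ⊗ φ` for some
bilinear Pfister form `B`. -/
def IsQPfisterFactor (k : ℕ) (φ ψ : QF F) : Prop :=
  IsQPfister k φ ∧ ∃ l : List F, UnitList l ∧ (btensor l φ).Equiv ψ

/-- A finite family of quadratic Pfister forms is (separably) `k`-linked if its members
share a common `k`-fold quadratic Pfister factor. -/
def SepLinked (k : ℕ) (ψs : List (QF F)) : Prop :=
  ∃ π : QF F, IsQPfister k π ∧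
    ∀ ψ ∈ ψs, ∃ l : List F, UnitList l ∧ (btensor l π).Equiv ψ

/-- A finite family of quadratic Pfister forms is inseparably `k`-linked if its members
share a common `k`-fold bilinear Pfister factor. -/
def InsepLinked (k : ℕ) (ψs : List (QF F)) : Prop :=
  ∃ l : List F, UnitList l ∧ l.length = k ∧
    ∀ ψ ∈ ψs, ∃ (n : ℕ) (π : QF F), IsQPfister n π ∧ (btensor l π).Equiv ψ

/-- `q` is the value of the two-form invariant `F²_k(ψ₁, ψ₂) = φ₁ ⊗ φ₂ ⊗ π`
for some presentation `ψ₁ ≅ φ₁ ⊗ π`, `ψ₂ ≅ φ₂ ⊗ π`. -/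
def IsPairInv (k : ℕ) (ψ₁ ψ₂ q : QF F) : Prop :=
  ∃ (π : QF F) (l₁ l₂ : List F), IsQPfister k π ∧ UnitList l₁ ∧ UnitList l₂ ∧
    (btensor l₁ π).Equiv ψ₁ ∧ (btensor l₂ π).Equiv ψ₂ ∧
    q.Equiv (btensor l₁ (btensor l₂ π))

/-- `IsInv k ψs q` : `q` is a value of the inductively defined invariant
`F^m_k(ψ₁,…,ψ_m)`, where `F¹_k(ψ) = ψ` and
`F^m_k(ψ₁,…,ψ_m) = F²_k(F^{m−1}_k(ψ₁,…,ψ_{m−1}), ψ_m)`. -/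
inductive IsInv (k : ℕ) : List (QF F) → QF F → Prop
  | single (ψ : QF F) : IsInv k [ψ] ψ
  | step {ψs : List (QF F)} {ψ q' q : QF F} :
      IsInv k ψs q' → IsPairInv k q' ψ q → IsInv k (ψs ++ [ψ]) q

end QF
namespace QF

variable {F : Type} [Field F]

/-- The (upper triangular) Gram-type matrix of a bundled quadratic form:
`q(∑ xᵢ eᵢ) = ∑ᵢ q(eᵢ) xᵢ² + ∑_{i<j} polar(eᵢ,eⱼ) xᵢ xⱼ`. -/
def matrixOf (q : QF F) : Matrix (Fin q.dim) (Fin q.dim) F := fun i j =>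
  if i = j then q.form (Pi.single i 1)
  else if i < j then polar q.form (Pi.single i 1) (Pi.single j 1)
  else 0

/-- Base change (extension of scalars) of a bundled quadratic form along a
ring homomorphism of fields. -/
def baseChange {E : Type} [Field E] (σ : F →+* E) (q : QF F) : QF E :=
  ⟨q.dim, (q.matrixOf.map σ).toQuadraticMap'⟩

/-- The homogeneous degree-2 polynomial cut out by a bundled quadratic form. -/
def toPoly (q : QF F) : MvPolynomial (Fin q.dim) F :=
  ∑ i, ∑ j, MvPolynomial.C (q.matrixOf i j) * (MvPolynomial.X i * MvPolynomial.X j)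

/-- The affine coordinate ring of the quadric `q = 0`. -/
def coordRing (q : QF F) : Type :=
  MvPolynomial (Fin q.dim) F ⧸ Ideal.span {q.toPoly}

instance (q : QF F) : CommRing q.coordRing := Ideal.Quotient.commRing _
instance (q : QF F) : Algebra F q.coordRing := Ideal.Quotient.algebra F

/-- The function field `F(q)` of the quadric `q = 0` (assuming the coordinate
ring is a domain). -/
def funField (q : QF F) : Type := FractionRing q.coordRing

instance (q : QF F) : CommRing q.funField := by unfold funField; infer_instance

noncomputable instance (q : QF F) [IsDomain q.coordRing] : Field q.funField := by
  unfold funField; infer_instance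

/-- The canonical embedding `F → F(q)`. -/
noncomputable def toFunField (q : QF F) : F →+* q.funField :=
  (algebraMap q.coordRing (FractionRing q.coordRing)).comp (algebraMap F q.coordRing)

/-- `⟨⟨γ₁,…,γ_m⟩⟩′ ⊗ q` : the tensor product with `q` of the pure part of the
bilinear Pfister form with slots `γ₁,…,γ_m`, so that
`⟨⟨l⟩⟩ ⊗ q ≅ q ⊥ (⟨⟨l⟩⟩′ ⊗ q)`. -/
def bpure : List F → QF F → QF F
  | [], _ => zero F
  | γ :: l, q => (bpure l q).sum ((-γ) • btensor l q)

end QF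

namespace QF

variable {F : Type} [Field F]

/-! ### Calculus of isometries -/

lemma Equiv.refl (q : QF F) : q.Equiv q := QuadraticMap.Equivalent.refl _

lemma Equiv.symm {q r : QF F} (h : q.Equiv r) : r.Equiv q := QuadraticMap.Equivalent.symm h

lemma Equiv.trans {q r s : QF F} (h : q.Equiv r) (h' : r.Equiv s) : q.Equiv s :=
  QuadraticMap.Equivalent.trans h h'

/-- The underlying quadratic form of an orthogonal sum is the product form. -/
def sumIsometry (q r : QF F) : (q.sum r).form.IsometryEquiv (q.form.prod r.form) :=
  (isometryEquivOfCompLinearEquiv _ (finSplit F q.dim r.dim)).symm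

lemma Equiv.of_linearEquiv {q r : QF F} (e : (Fin q.dim → F) ≃ₗ[F] (Fin r.dim → F))
    (h : ∀ v, r.form (e v) = q.form v) : q.Equiv r :=
  ⟨{ e with map_app' := h }⟩

lemma Equiv.sum {q q' r r' : QF F} (h : q.Equiv q') (h' : r.Equiv r') :
    (q.sum r).Equiv (q'.sum r') :=
  Equivalent.trans ⟨sumIsometry q r⟩
    ((Equivalent.prod h h').trans ⟨(sumIsometry q' r').symm⟩)

lemma Equiv.smul {q r : QF F} (a : F) (h : q.Equiv r) : (a • q).Equiv (a • r) := by
  obtain ⟨e⟩ := h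
  exact ⟨{ e.toLinearEquiv with map_app' := fun v => congrArg (a • ·) (e.map_app v) }⟩

lemma sum_comm_equiv (q r : QF F) : (q.sum r).Equiv (r.sum q) :=
  ⟨(sumIsometry q r).trans ((IsometryEquiv.prodComm _ _).trans (sumIsometry r q).symm)⟩

lemma sum_assoc_equiv (q r s : QF F) : ((q.sum r).sum s).Equiv (q.sum (r.sum s)) := by
  have h₁ : ((q.sum r).form.prod s.form).Equivalent ((q.form.prod r.form).prod s.form) :=
    Equivalent.prod ⟨sumIsometry q r⟩ (Equivalent.refl _)
  have h₂ : ((q.form.prod r.form).prod s.form).Equivalent (q.form.prod (r.form.prod s.form)) :=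
    ⟨{ LinearEquiv.prodAssoc F _ _ _ with map_app' := fun v => (add_assoc _ _ _).symm }⟩
  have h₃ : (q.form.prod (r.form.prod s.form)).Equivalent (q.form.prod (r.sum s).form) :=
    Equivalent.prod (Equivalent.refl _) ⟨(sumIsometry r s).symm⟩
  exact Equivalent.trans ⟨sumIsometry _ _⟩
    (h₁.trans (h₂.trans (h₃.trans ⟨(sumIsometry _ _).symm⟩)))

lemma sum_sum_sum_comm_equiv (q r s t : QF F) :
    ((q.sum r).sum (s.sum t)).Equiv ((q.sum s).sum (r.sum t)) :=
  Equivalent.trans ⟨sumIsometry _ _⟩ <|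
    (Equivalent.prod ⟨sumIsometry q r⟩ ⟨sumIsometry s t⟩).trans <|
    Equivalent.trans ⟨IsometryEquiv.prodProdProdComm _ _ _ _⟩ <|
    (Equivalent.prod ⟨(sumIsometry q s).symm⟩ ⟨(sumIsometry r t).symm⟩).trans
    ⟨(sumIsometry _ _).symm⟩

lemma smul_sum_equiv (a : F) (q r : QF F) : (a • q.sum r).Equiv ((a • q).sum (a • r)) :=
  Equiv.of_linearEquiv (LinearEquiv.refl F _) fun _ => (mul_add a _ _).symm

lemma smul_smul_equiv (a b : F) (q : QF F) : (a • b • q).Equiv ((a * b) • q) :=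
  Equiv.of_linearEquiv (LinearEquiv.refl F _) fun _ => mul_assoc a b _

lemma mul_self_smul_equiv {a : F} (ha : a ≠ 0) (q : QF F) : ((a * a) • q).Equiv q :=
  Equiv.of_linearEquiv (LinearEquiv.smulOfNeZero F (Fin q.dim → F) a ha) fun v =>
    QuadraticMap.map_smul q.form a v

lemma zero_sum_equiv (q : QF F) : ((zero F).sum q).Equiv q := by
  have : Subsingleton (Fin (zero F).dim → F) := inferInstanceAs (Subsingleton (Fin 0 → F))
  have h : ((zero F).form.prod q.form).Equivalent q.form :=
    ⟨{ LinearMap.snd F _ _ with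
        invFun := fun v => (0, v)
        left_inv := fun v => Prod.ext (Subsingleton.elim _ _) rfl
        right_inv := fun v => rfl
        map_app' := fun v => (zero_add _).symm }⟩
  exact Equivalent.trans ⟨sumIsometry _ _⟩ h

lemma dim_eq_of_equiv {q r : QF F} (h : q.Equiv r) : q.dim = r.dim := by
  obtain ⟨e⟩ := h
  simpa using e.toLinearEquiv.finrank_eq

lemma sum_form_apply (q r : QF F) (v : Fin (q.sum r).dim → F) :
    (q.sum r).form v = q.form (sumIsometry q r v).1 + r.form (sumIsometry q r v).2 :=
  ((sumIsometry q r).map_app v).symm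

lemma Equiv.twist {q r : QF F} (γ : F) (h : q.Equiv r) : (twist γ q).Equiv (twist γ r) :=
  h.sum (h.smul _)

lemma Equiv.btensor {q r : QF F} (l : List F) (h : q.Equiv r) :
    (btensor l q).Equiv (btensor l r) := by
  induction l with
  | nil => exact h
  | cons γ l ih => exact ih.twist γ

lemma btensor_append (l l' : List F) (q : QF F) :
    btensor (l ++ l') q = btensor l (btensor l' q) :=
  List.foldr_append

lemma btensor_dim (l : List F) (q : QF F) : (btensor l q).dim = 2 ^ l.length * q.dim := by
  induction l with
  | nil => exact (one_mul _).symm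
  | cons γ l ih =>
    change (btensor l q).dim + (btensor l q).dim = _
    rw [ih, List.length_cons, pow_succ]
    ring

lemma binary_apply (α : F) (v : Fin 2 → F) :
    (binary α).form v = v 0 * v 0 + v 0 * v 1 + α * (v 1 * v 1) := by
  change Matrix.toLinearMap₂' F (Matrix.of ![![1, 1], ![0, α]]) v v = _
  simp [Matrix.toLinearMap₂'_apply, Fin.sum_univ_two]
  ring

lemma hyp_apply (v : Fin 2 → F) : (hyp F).form v = v 0 * v 1 := by
  change Matrix.toLinearMap₂' F (Matrix.of ![![0, 1], ![0, 0]]) v v = _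
  simp [Matrix.toLinearMap₂'_apply, Fin.sum_univ_two]

lemma unit_apply (v : Fin 1 → F) : (unit F).form v = v 0 * v 0 := rfl

/-! ### Hyperbolic forms -/

lemma hyps_add_equiv (m n : ℕ) : ((hyps F m).sum (hyps F n)).Equiv (hyps F (m + n)) := by
  induction m with
  | zero =>
    rw [Nat.zero_add]
    exact zero_sum_equiv (hyps F n)
  | succ m ih =>
    rw [Nat.succ_add]
    exact (sum_assoc_equiv _ _ _).trans ((Equiv.refl _).sum ih)

/-- Two binary forms related by an invertible linear substitution are isometric. -/
lemma equivalent_of_det_ne_zero {Q Q' : QuadraticForm F (Fin 2 → F)} (a b c d : F)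
    (hdet : a * d - b * c ≠ 0)
    (h : ∀ v, Q' ![a * v 0 + b * v 1, c * v 0 + d * v 1] = Q v) : Q.Equivalent Q' := by
  have hf : ∀ v, Matrix.mulVecLin !![a, b; c, d] v = ![a * v 0 + b * v 1, c * v 0 + d * v 1] := by
    intro v
    ext i
    fin_cases i <;> simp [Matrix.mulVec, dotProduct, Fin.sum_univ_two]
  have hinj : Function.Injective (Matrix.mulVecLin !![a, b; c, d]) := by
    rw [Matrix.coe_mulVecLin, Matrix.mulVec_injective_iff_isUnit, Matrix.isUnit_iff_isUnit_det,
      Matrix.det_fin_two_of]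
    exact hdet.isUnit
  exact ⟨{ LinearEquiv.ofInjectiveEndo _ hinj with
    map_app' := fun v => (congrArg Q' (hf v)).trans (h v) }⟩

lemma smul_hyp_equiv {a : F} (ha : a ≠ 0) : (a • hyp F).Equiv (hyp F) := by
  refine equivalent_of_det_ne_zero (Q := (a • hyp F).form) (Q' := (hyp F).form) a 0 0 1
    (by simpa using ha) fun v => ?_
  refine (hyp_apply _).trans (Eq.trans ?_ (congrArg (a * ·) (hyp_apply v)).symm)
  simp [mul_assoc]

lemma smul_hyps_equiv {a : F} (ha : a ≠ 0) (m : ℕ) : (a • hyps F m).Equiv (hyps F m) := by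
  induction m with
  | zero => exact Equiv.of_linearEquiv (LinearEquiv.refl F _) fun _ => (mul_zero a).symm
  | succ m ih => exact (smul_sum_equiv a _ _).trans ((smul_hyp_equiv ha).sum ih)

lemma Hyperbolic.congr {q r : QF F} (h : q.Hyperbolic) (e : r.Equiv q) : r.Hyperbolic :=
  h.imp fun _ h => e.trans h

lemma Hyperbolic.sum {q r : QF F} (hq : q.Hyperbolic) (hr : r.Hyperbolic) :
    (q.sum r).Hyperbolic := by
  obtain ⟨m, hm⟩ := hq
  obtain ⟨n, hn⟩ := hr
  exact ⟨m + n, (hm.sum hn).trans (hyps_add_equiv m n)⟩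

lemma Hyperbolic.smul {q : QF F} (hq : q.Hyperbolic) {a : F} (ha : a ≠ 0) :
    (a • q).Hyperbolic :=
  hq.imp fun m hm => (hm.smul a).trans (smul_hyps_equiv ha m)

lemma hyp_hyperbolic : (hyp F).Hyperbolic :=
  ⟨1, (zero_sum_equiv _).symm.trans (sum_comm_equiv _ _)⟩

lemma Hyperbolic.twist {q : QF F} (hq : q.Hyperbolic) {γ : F} (hγ : γ ≠ 0) :
    (twist γ q).Hyperbolic :=
  hq.sum (hq.smul (neg_ne_zero.2 hγ))

lemma UnitList.head {γ : F} {l : List F} (h : UnitList (γ :: l)) : γ ≠ 0 :=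
  h γ List.mem_cons_self

lemma UnitList.tail {γ : F} {l : List F} (h : UnitList (γ :: l)) : UnitList l :=
  fun δ hδ => h δ (List.mem_cons_of_mem _ hδ)

lemma UnitList.append {l l' : List F} (h : UnitList l) (h' : UnitList l') :
    UnitList (l ++ l') := fun δ hδ =>
  (List.mem_append.1 hδ).elim (h δ) (h' δ)

/-! ### Embeddings -/

/-- `q.Embeds r` means that `q` is isometric to the restriction of `r` to a subspace. -/
def Embeds (q r : QF F) : Prop := ∃ f : q.form →qᵢ r.form, Function.Injective f

lemma Equiv.embeds {q r : QF F} (h : q.Equiv r) : q.Embeds r := by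
  obtain ⟨e⟩ := h
  exact ⟨e.toIsometry, EquivLike.injective e⟩

lemma Embeds.trans {q r s : QF F} (h : q.Embeds r) (h' : r.Embeds s) : q.Embeds s := by
  obtain ⟨f, hf⟩ := h
  obtain ⟨g, hg⟩ := h'
  exact ⟨g.comp f, hg.comp hf⟩

lemma Embeds.sum {q q' r r' : QF F} (h : q.Embeds q') (h' : r.Embeds r') :
    (q.sum r).Embeds (q'.sum r') := by
  obtain ⟨f, hf⟩ := h
  obtain ⟨g, hg⟩ := h'
  let fg : (q.form.prod r.form) →qᵢ (q'.form.prod r'.form) :=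
    { f.toLinearMap.prodMap g.toLinearMap with
      map_app' := fun v => congrArg₂ (· + ·) (f.map_app v.1) (g.map_app v.2) }
  refine ⟨(sumIsometry q' r').symm.toIsometry.comp (fg.comp (sumIsometry q r).toIsometry), ?_⟩
  exact (EquivLike.injective (sumIsometry q' r').symm).comp
    ((hf.prodMap hg).comp (EquivLike.injective (sumIsometry q r)))

lemma Embeds.smul {q r : QF F} (a : F) (h : q.Embeds r) : (a • q).Embeds (a • r) := by
  obtain ⟨f, hf⟩ := h
  exact ⟨{ f.toLinearMap with map_app' := fun v => congrArg (a • ·) (f.map_app v) }, hf⟩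

lemma embeds_sum_left (q r : QF F) : q.Embeds (q.sum r) :=
  ⟨(sumIsometry q r).symm.toIsometry.comp (QuadraticMap.Isometry.inl _ _),
    (EquivLike.injective (sumIsometry q r).symm).comp (Prod.mk_left_injective 0)⟩

lemma Embeds.btensor {q r : QF F} (h : q.Embeds r) (l : List F) :
    (btensor l q).Embeds (btensor l r) := by
  induction l with
  | nil => exact h
  | cons γ l ih => exact ih.sum (ih.smul _)

lemma embeds_btensor (l : List F) (q : QF F) : q.Embeds (btensor l q) := by
  induction l with
  | nil => exact (Equiv.refl q).embeds
  | cons γ l ih => exact ih.trans (embeds_sum_left _ _)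

lemma btensor_equiv_sum_bpure (l : List F) (q : QF F) :
    (btensor l q).Equiv (q.sum (bpure l q)) := by
  induction l with
  | nil => exact (zero_sum_equiv q).symm.trans (sum_comm_equiv _ _)
  | cons γ l ih => exact (ih.sum (Equiv.refl _)).trans (sum_assoc_equiv _ _ _)

lemma Embeds.bpure {q r : QF F} (h : q.Embeds r) (l : List F) :
    (bpure l q).Embeds (bpure l r) := by
  induction l with
  | nil => exact (Equiv.refl _).embeds
  | cons γ l ih => exact ih.sum ((h.btensor l).smul _)

lemma Isotropic.of_embeds {q r : QF F} (hq : q.Isotropic) (h : q.Embeds r) : r.Isotropic := by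
  obtain ⟨v, hv, hv0⟩ := hq
  obtain ⟨f, hf⟩ := h
  exact ⟨f v, (f.map_app v).trans hv, fun h0 => hv0 (hf (h0.trans (map_zero f).symm))⟩

lemma unit_embeds_binary (α : F) : (unit F).Embeds (binary α) := by
  let f : (Fin 1 → F) →ₗ[F] (Fin 2 → F) :=
    LinearMap.toSpanSingleton F (Fin 2 → F) (Pi.single 0 1) ∘ₗ LinearMap.proj 0
  have hf : ∀ v, (binary α).form (f v) = (unit F).form v := fun v => by
    rw [binary_apply, unit_apply]
    simp [f]
  have hinj : Function.Injective f := fun v w h => by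
    have := congrFun h 0
    ext i
    obtain rfl := Subsingleton.elim i 0
    simpa [f] using this
  exact ⟨{ f with map_app' := hf }, hinj⟩

/-! ### Roundness and isotropic Pfister forms -/

/-- A form is round if it is similar to itself by every nonzero value that it represents. -/
def Round (q : QF F) : Prop := ∀ v, q.form v ≠ 0 → (q.form v • q).Equiv q

lemma round_binary (α : F) : (binary α).Round := by
  intro (v : Fin 2 → F) hv
  have hN := binary_apply α v
  refine equivalent_of_det_ne_zero (Q := ((binary α).form v • binary α).form)
    (Q' := (binary α).form) (v 0) (-α * v 1) (v 1) (v 0 + v 1)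
    (fun h => hv (hN.trans (Eq.trans (by ring) h))) fun w => ?_
  refine (binary_apply _ _).trans
    (Eq.trans ?_ (congrArg₂ (· * ·) hN (binary_apply α w)).symm)
  simp
  ring

lemma btensor_sum_self_hyperbolic {l : List F} (hl : UnitList l) {q : QF F}
    (hq : (q.sum q).Hyperbolic) : ((btensor l q).sum (btensor l q)).Hyperbolic := by
  induction l with
  | nil => exact hq
  | cons γ l ih =>
    have h := ih hl.tail
    exact (h.sum (h.smul (neg_ne_zero.2 hl.head))).congr
      ((sum_sum_sum_comm_equiv _ _ _ _).trans ((Equiv.refl _).sum (smul_sum_equiv _ _ _).symm))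

lemma polar_isometry {V W : Type*} [AddCommGroup V] [Module F V] [AddCommGroup W] [Module F W]
    {Q : QuadraticForm F V} {Q' : QuadraticForm F W} (f : Q →qᵢ Q') (x y : V) :
    polar Q' (f x) (f y) = polar Q x y := by
  simp only [polar, ← map_add f, f.map_app]

lemma polar_sum_smul (γ : F) (q : QF F) (x y : Fin (q.sum (γ • q)).dim → F) :
    polar (q.sum (γ • q)).form x y =
      polar q.form (sumIsometry q (γ • q) x).1 (sumIsometry q (γ • q) y).1 +
        γ * polar q.form (sumIsometry q (γ • q) x).2 (sumIsometry q (γ • q) y).2 := by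
  rw [← polar_isometry (sumIsometry q (γ • q)).toIsometry]
  refine (polar_prod _ _ _ _).trans (congrArg₂ (· + ·) rfl ?_)
  exact polar_smul q.form γ _ _

/-- The polar form of `q` has trivial radical. -/
def PolarNondegenerate (q : QF F) : Prop := ∀ x, (∀ y, polar q.form x y = 0) → x = 0

lemma PolarNondegenerate.congr {q r : QF F} (hq : q.PolarNondegenerate) (h : r.Equiv q) :
    r.PolarNondegenerate := by
  obtain ⟨e⟩ := h
  intro x hx
  refine (EquivLike.injective e) ((hq (e x) fun y => ?_).trans (map_zero e).symm)
  rw [← hx (e.symm y), ← polar_isometry e.toIsometry]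
  exact congrArg _ (e.apply_symm_apply y).symm

lemma PolarNondegenerate.polarBilin_nondegenerate {q : QF F} (hq : q.PolarNondegenerate) :
    q.form.polarBilin.Nondegenerate :=
  ⟨hq, fun y hy => hq y fun x => (polar_comm _ _ _).trans (hy x)⟩

section CharTwo

variable [CharP F 2]

lemma twist_eq (γ : F) (q : QF F) : twist γ q = q.sum (γ • q) := by
  rw [twist, CharTwo.neg_eq]

/-- `⟨a, b⟩ ⊗ q ≅ ⟨a + b, (a + b)ab⟩ ⊗ q`. -/
lemma smul_sum_smul_equiv {a b : F} (hab : a + b ≠ 0) (q : QF F) :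
    ((a • q).sum (b • q)).Equiv (((a + b) • q).sum (((a + b) * (a * b)) • q)) := by
  let e : ((Fin q.dim → F) × (Fin q.dim → F)) →ₗ[F] ((Fin q.dim → F) × (Fin q.dim → F)) :=
    (LinearMap.fst F _ _ + b • LinearMap.snd F _ _).prod
      (LinearMap.fst F _ _ + a • LinearMap.snd F _ _)
  have hinj : Function.Injective e := by
    rw [injective_iff_map_eq_zero]
    rintro ⟨x, y⟩ h
    obtain ⟨h₁, h₂⟩ := Prod.ext_iff.1 h
    replace h₁ : x + b • y = 0 := h₁
    replace h₂ : x + a • y = 0 := h₂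
    have hy : (a + b) • y = 0 := by
      rw [← CharTwo.sub_eq_add, sub_smul, ← add_sub_add_left_eq_sub _ _ x, h₁, h₂, sub_zero]
    obtain rfl : y = 0 := (smul_eq_zero.1 hy).resolve_left hab
    simpa using h₁
  have key : (((a + b) • q).form.prod (((a + b) * (a * b)) • q).form).Equivalent
      ((a • q).form.prod (b • q).form) := by
    refine ⟨{ LinearEquiv.ofInjectiveEndo e hinj with map_app' := fun v => ?_ }⟩
    obtain ⟨x, y⟩ := v
    change a * q.form (x + b • y) + b * q.form (x + a • y) =
      (a + b) * q.form x + (a + b) * (a * b) * q.form y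
    simp only [QuadraticMap.map_add q.form, QuadraticMap.map_smul,
      QuadraticMap.polar_smul_right, smul_eq_mul]
    linear_combination (a * b * polar q.form x y) * CharTwo.two_eq_zero (R := F)
  exact Equivalent.trans ⟨sumIsometry _ _⟩ (key.symm.trans ⟨(sumIsometry _ _).symm⟩)

lemma Round.twist {q : QF F} (hq : q.Round) {γ : F} (hγ : γ ≠ 0) : (twist γ q).Round := by
  rw [twist_eq]
  intro v hv
  set x := (sumIsometry q (γ • q) v).1
  set y := (sumIsometry q (γ • q) v).2
  have hval : (q.sum (γ • q)).form v = q.form x + γ * q.form y := sum_form_apply _ _ v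
  rw [hval] at hv ⊢
  set s := q.form x with hs
  set t := q.form y with ht
  by_cases hs0 : s = 0
  · rw [hs0, zero_add] at hv ⊢
    have ht0 : t ≠ 0 := right_ne_zero_of_mul hv
    refine (smul_sum_equiv _ _ _).trans ((sum_comm_equiv _ _).trans (Equiv.sum ?_ ?_))
    · refine (smul_smul_equiv _ _ _).trans ?_
      rw [mul_right_comm]
      refine (smul_smul_equiv _ _ _).symm.trans ?_
      exact (mul_self_smul_equiv hγ _).trans (hq y ht0)
    · exact (smul_smul_equiv _ _ _).symm.trans ((hq y ht0).smul γ)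
  · by_cases ht0 : t = 0
    · rw [ht0, mul_zero, add_zero]
      refine (smul_sum_equiv _ _ _).trans (Equiv.sum (hq x hs0) ?_)
      refine (smul_smul_equiv _ _ _).trans ?_
      rw [mul_comm]
      exact (smul_smul_equiv _ _ _).symm.trans ((hq x hs0).smul γ)
    · have hst : ((s * t) • q).Equiv q :=
        (smul_smul_equiv _ _ _).symm.trans (((hq y ht0).smul s).trans (hq x hs0))
      have h₁ : (q.sum (γ • q)).Equiv ((s • q).sum ((γ * t) • q)) :=
        (hq x hs0).symm.sum ((((hq y ht0).smul γ).symm).trans (smul_smul_equiv _ _ _))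
      have h₂ : (((s + γ * t) * (s * (γ * t))) • q).Equiv ((s + γ * t) • γ • q) := by
        rw [mul_left_comm s γ t]
        exact (smul_smul_equiv _ _ _).symm.trans
          (((smul_smul_equiv _ _ _).symm.trans (hst.smul γ)).smul _)
      exact (h₁.trans ((smul_sum_smul_equiv hv q).trans (((Equiv.refl _).sum h₂).trans
        (smul_sum_equiv _ _ _).symm))).symm

lemma round_btensor_binary {l : List F} (hl : UnitList l) (α : F) :
    (btensor l (binary α)).Round := by
  induction l with
  | nil => exact round_binary α
  | cons γ l ih => exact (ih hl.tail).twist hl.head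

lemma binary_sum_self_hyperbolic (α : F) : ((binary α).sum (binary α)).Hyperbolic := by
  let e : ((Fin 2 → F) × (Fin 2 → F)) →ₗ[F] ((Fin 2 → F) × (Fin 2 → F)) :=
    { toFun := fun v => (![v.1 0 + v.2 0, v.1 0 + v.2 0 + v.1 1],
        ![v.1 1 + v.2 1, α * (v.1 1 + v.2 1) + v.2 0])
      map_add' := fun v w => by ext i <;> fin_cases i <;> simp <;> ring
      map_smul' := fun c v => by ext i <;> fin_cases i <;> simp <;> ring }
  have hinj : Function.Injective e := by
    rw [injective_iff_map_eq_zero]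
    rintro ⟨v, w⟩ h
    obtain ⟨h₁, h₂⟩ := Prod.ext_iff.1 h
    have h₁₀ : v 0 + w 0 = 0 := congrFun h₁ 0
    have h₁₁ : v 0 + w 0 + v 1 = 0 := congrFun h₁ 1
    have h₂₀ : v 1 + w 1 = 0 := congrFun h₂ 0
    have h₂₁ : α * (v 1 + w 1) + w 0 = 0 := congrFun h₂ 1
    have hv₁ : v 1 = 0 := by simpa [h₁₀] using h₁₁
    have hw₀ : w 0 = 0 := by simpa [h₂₀] using h₂₁
    refine Prod.ext (funext (Fin.forall_fin_two.2 ⟨?_, hv₁⟩))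
      (funext (Fin.forall_fin_two.2 ⟨hw₀, ?_⟩))
    · simpa [hw₀] using h₁₀
    · simpa [hv₁] using h₂₀
  have key : ((binary α).form.prod (binary α).form).Equivalent
      ((hyp F).form.prod (hyp F).form) := by
    refine ⟨{ LinearEquiv.ofInjectiveEndo e hinj with map_app' := fun v => ?_ }⟩
    refine (congrArg₂ (· + ·) (hyp_apply _) (hyp_apply _)).trans
      (Eq.trans ?_ (congrArg₂ (· + ·) (binary_apply α _) (binary_apply α _)).symm)
    obtain ⟨(x : Fin 2 → F), (y : Fin 2 → F)⟩ := v
    change (x 0 + y 0) * (x 0 + y 0 + x 1) + (x 1 + y 1) * (α * (x 1 + y 1) + y 0) =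
      x 0 * x 0 + x 0 * x 1 + α * (x 1 * x 1) + (y 0 * y 0 + y 0 * y 1 + α * (y 1 * y 1))
    linear_combination (x 0 * y 0 + y 0 * x 1 + α * x 1 * y 1) * CharTwo.two_eq_zero (R := F)
  exact (hyp_hyperbolic.sum hyp_hyperbolic).congr
    (Equivalent.trans ⟨sumIsometry _ _⟩ (key.trans ⟨(sumIsometry _ _).symm⟩))

lemma Isotropic.hyperbolic_binary {α : F} (h : (binary α).Isotropic) :
    (binary α).Hyperbolic := by
  obtain ⟨(v : Fin 2 → F), hv, hv0⟩ := h
  replace hv := (binary_apply α v).symm.trans hv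
  have h₁ : v 1 ≠ 0 := by
    intro h₁
    refine hv0 ?_
    have h₀ : v 0 = 0 := by simpa [h₁] using hv
    ext i
    revert i
    exact Fin.forall_fin_two.2 ⟨h₀, h₁⟩
  obtain ⟨s, hs⟩ : ∃ s : F, s * s + s + α = 0 := by
    refine ⟨v 0 / v 1, ?_⟩
    field_simp
    linear_combination hv
  refine hyp_hyperbolic.congr (equivalent_of_det_ne_zero (Q := (binary α).form)
    (Q' := (hyp F).form) 1 (-s) 1 (s + 1) ?_ fun w => ?_)
  · have : (1 : F) * (s + 1) - -s * 1 = 1 := by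
      linear_combination s * CharTwo.two_eq_zero (R := F)
    rw [this]
    exact one_ne_zero
  · refine (hyp_apply _).trans (Eq.trans ?_ (binary_apply α w).symm)
    simp
    linear_combination -(w 1 * w 1) * hs

/-- An isotropic quadratic Pfister form is hyperbolic. -/
lemma Isotropic.hyperbolic_btensor_binary {l : List F} (hl : UnitList l) {α : F}
    (h : (btensor l (binary α)).Isotropic) : (btensor l (binary α)).Hyperbolic := by
  induction l with
  | nil => exact h.hyperbolic_binary
  | cons γ l ih =>
    set ρ := btensor l (binary α)
    by_cases hiso : ρ.Isotropic
    · exact (ih hl.tail hiso).twist hl.head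
    · change (QF.twist γ ρ).Hyperbolic
      replace h : (QF.twist γ ρ).Isotropic := h
      rw [twist_eq] at h ⊢
      obtain ⟨v, hv, hv0⟩ := h
      set x := (sumIsometry ρ (γ • ρ) v).1
      set y := (sumIsometry ρ (γ • ρ) v).2
      have hval : ρ.form x + γ * ρ.form y = 0 := (sum_form_apply _ _ v).symm.trans hv
      have han : ∀ z, ρ.form z = 0 → z = 0 := fun z hz => by_contra fun hz0 => hiso ⟨z, hz, hz0⟩
      have hxy : ρ.form x = γ * ρ.form y := CharTwo.add_eq_zero.1 hval
      have hy0 : ρ.form y ≠ 0 := by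
        intro hy0
        rw [hy0, mul_zero] at hxy
        refine hv0 ((EquivLike.injective (sumIsometry ρ (γ • ρ))) ?_)
        rw [map_zero]
        exact Prod.ext (han x hxy) (han y hy0)
      have hx0 : ρ.form x ≠ 0 := hxy ▸ mul_ne_zero hl.head hy0
      have hround := round_btensor_binary hl.tail α
      have hγ : (γ • ρ).Equiv ρ :=
        ((hround y hy0).smul γ).symm.trans
          ((smul_smul_equiv _ _ _).trans (hxy ▸ hround x hx0))
      exact (btensor_sum_self_hyperbolic hl.tail (binary_sum_self_hyperbolic α)).congr
        ((Equiv.refl _).sum hγ)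

/-! ### Nondegeneracy -/

lemma PolarNondegenerate.twist {q : QF F} (hq : q.PolarNondegenerate) {γ : F} (hγ : γ ≠ 0) :
    (twist γ q).PolarNondegenerate := by
  rw [twist_eq]
  intro x hx
  set e := sumIsometry q (γ • q)
  have hpol : ∀ y : (Fin q.dim → F) × (Fin q.dim → F),
      polar q.form (e x).1 y.1 + γ * polar q.form (e x).2 y.2 = 0 := by
    intro y
    have h := polar_sum_smul γ q x (e.symm y)
    rw [hx, e.apply_symm_apply] at h
    exact h.symm
  refine (EquivLike.injective e) (Eq.trans (Prod.ext (hq _ fun y => ?_) (hq _ fun y => ?_))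
    (map_zero e).symm)
  · simpa using hpol (y, 0)
  · simpa [hγ] using hpol (0, y)

lemma polarNondegenerate_binary (α : F) : (binary α).PolarNondegenerate := by
  intro (x : Fin 2 → F) hx
  have hx' : ∀ y : Fin 2 → F, x 0 * y 1 + x 1 * y 0 = 0 := by
    intro y
    rw [← hx y]
    refine Eq.trans ?_ (congrArg₂ (· - ·) (congrArg₂ (· - ·) (binary_apply α _)
      (binary_apply α x)) (binary_apply α y)).symm
    change _ = (x 0 + y 0) * (x 0 + y 0) + (x 0 + y 0) * (x 1 + y 1) +
      α * ((x 1 + y 1) * (x 1 + y 1)) - _ - _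
    linear_combination -(x 0 * y 0 + α * x 1 * y 1) * CharTwo.two_eq_zero (R := F)
  refine funext (Fin.forall_fin_two.2 ⟨?_, ?_⟩)
  · change x 0 = (0 : F)
    simpa using hx' ![0, 1]
  · change x 1 = (0 : F)
    simpa using hx' ![1, 0]

lemma polarNondegenerate_btensor_binary {l : List F} (hl : UnitList l) (α : F) :
    (btensor l (binary α)).PolarNondegenerate := by
  induction l with
  | nil => exact polarNondegenerate_binary α
  | cons γ l ih => exact (ih hl.tail).twist hl.head

lemma polar_btensor_unit (l : List F) :
    ∀ x y, polar (btensor l (unit F)).form x y = 0 := by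
  induction l with
  | nil =>
    intro (x : Fin 1 → F) (y : Fin 1 → F)
    change (x 0 + y 0) * (x 0 + y 0) - x 0 * x 0 - y 0 * y 0 = 0
    linear_combination x 0 * y 0 * CharTwo.two_eq_zero (R := F)
  | cons γ l ih =>
    change ∀ x y, polar (QF.twist γ (btensor l (unit F))).form x y = 0
    rw [twist_eq]
    intro x y
    rw [polar_sum_smul, ih, ih, mul_zero, add_zero]

/-! ### Common totally singular subforms -/

/-- If a totally singular form `b`, of dimension at least that of a nondegenerate form `π`,
embeds in both `π ⊥ a₁` and `π ⊥ a₂`, then `π ⊥ a₁ ⊥ a₂` is isotropic as soon as `b` and `π`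
represent a common value. -/
lemma exists_isotropic_prod_prod {P A₁ A₂ B : Type*}
    [AddCommGroup P] [Module F P] [FiniteDimensional F P]
    [AddCommGroup A₁] [Module F A₁] [AddCommGroup A₂] [Module F A₂]
    [AddCommGroup B] [Module F B] [FiniteDimensional F B]
    {π : QuadraticForm F P} {a₁ : QuadraticForm F A₁} {a₂ : QuadraticForm F A₂}
    {b : QuadraticForm F B} (hπ : π.polarBilin.Nondegenerate)
    (hb : ∀ x y, polar b x y = 0) (hdim : Module.finrank F P ≤ Module.finrank F B)
    (f₁ : b →qᵢ π.prod a₁) (hf₁ : Function.Injective f₁) (f₂ : b →qᵢ π.prod a₂)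
    {w₀ : B} {p₀ : P} (h₀ : π p₀ = b w₀) (hp₀ : p₀ ≠ 0) :
    ∃ v, ((π.prod a₁).prod a₂) v = 0 ∧ v ≠ 0 := by
  set p₁ : B →ₗ[F] P := LinearMap.fst F P A₁ ∘ₗ f₁.toLinearMap
  set u₁ : B →ₗ[F] A₁ := LinearMap.snd F P A₁ ∘ₗ f₁.toLinearMap
  set p₂ : B →ₗ[F] P := LinearMap.fst F P A₂ ∘ₗ f₂.toLinearMap
  set u₂ : B →ₗ[F] A₂ := LinearMap.snd F P A₂ ∘ₗ f₂.toLinearMap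
  have hval₁ : ∀ w, π (p₁ w) + a₁ (u₁ w) = b w := fun w => f₁.map_app w
  have hval₂ : ∀ w, π (p₂ w) + a₂ (u₂ w) = b w := fun w => f₂.map_app w
  have hpol₁ : ∀ w w', u₁ w' = 0 → polar π (p₁ w) (p₁ w') = 0 := by
    intro w w' h
    have h' : polar π (p₁ w) (p₁ w') + polar a₁ (u₁ w) (u₁ w') = 0 :=
      (polar_prod π a₁ (f₁ w) (f₁ w')).symm.trans ((polar_isometry f₁ w w').trans (hb w w'))
    simpa [h] using h'
  have hpol₂ : ∀ w w', u₂ w' = 0 → polar π (p₂ w) (p₂ w') = 0 := by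
    intro w w' h
    have h' : polar π (p₂ w) (p₂ w') + polar a₂ (u₂ w) (u₂ w') = 0 :=
      (polar_prod π a₂ (f₂ w) (f₂ w')).symm.trans ((polar_isometry f₂ w w').trans (hb w w'))
    simpa [h] using h'
  let R : Submodule F B := LinearMap.ker u₁ ⊓ LinearMap.ker u₂ ⊓ LinearMap.ker (p₁ - p₂)
  have hR : ∀ w, w ∈ R ↔ (u₁ w = 0 ∧ u₂ w = 0) ∧ p₁ w = p₂ w := fun w => by
    simp [R, sub_eq_zero]
  let T : B × F →ₗ[F] P := (p₁ + p₂).coprod (LinearMap.toSpanSingleton F P (p₁ w₀))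
  have hT : ∀ w s, T (w, s) = p₁ w + p₂ w + s • p₁ w₀ := fun w s => by
    simp [T]
  have hrange : LinearMap.range T ≤ LinearMap.BilinForm.orthogonal π.polarBilin (R.map p₁) := by
    rintro _ ⟨⟨w, s⟩, rfl⟩ _ ⟨w', hw', rfl⟩
    obtain ⟨⟨h₁, h₂⟩, h₃⟩ := (hR w').1 hw'
    change polar π (p₁ w') (T (w, s)) = 0
    rw [polar_comm, hT, polar_add_left, polar_add_left, polar_smul_left, hpol₁ _ _ h₁,
      hpol₁ _ _ h₁, h₃, hpol₂ _ _ h₂]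
    simp
  have hmap : Module.finrank F (R.map p₁) = Module.finrank F R := by
    rw [← LinearMap.range_domRestrict]
    refine LinearMap.finrank_range_of_inj ((injective_iff_map_eq_zero _).2 ?_)
    rintro ⟨w, hw⟩ h
    exact Subtype.ext (hf₁ ((Prod.ext h ((hR w).1 hw).1.1).trans (map_zero f₁).symm))
  obtain ⟨⟨w, s⟩, hker, hnot⟩ : ∃ v ∈ LinearMap.ker T, v ∉ R.prod ⊥ := by
    by_contra! hle
    have h₁ := Submodule.finrank_mono (show LinearMap.ker T ≤ R.prod ⊥ from hle)
    have h₂ := Submodule.finrank_mono hrange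
    have h₃ := T.finrank_range_add_finrank_ker
    have h₄ := LinearMap.BilinForm.finrank_orthogonal hπ (R.map p₁)
    have h₅ := Submodule.finrank_le (R.map p₁)
    have h₆ : Module.finrank F (R.prod (⊥ : Submodule F F)) ≤ Module.finrank F R := by
      rw [← Submodule.map_inl]
      exact Submodule.finrank_map_le _ _
    rw [Module.finrank_prod, Module.finrank_self] at h₃
    omega
  replace hker : p₁ w + p₂ w + s • p₁ w₀ = 0 := (hT w s).symm.trans hker
  have hp : p₁ (w + s • w₀) = p₂ w := by
    have h2 : p₂ w + p₂ w = 0 := by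
      rw [← two_smul F, CharTwo.two_eq_zero, zero_smul]
    rw [map_add, map_smul, ← sub_eq_zero, ← hker, sub_eq_iff_eq_add, ← add_zero (p₁ w + _), ← h2]
    abel
  refine ⟨((s • p₀, u₁ (w + s • w₀)), u₂ w), ?_, fun hv => hnot ?_⟩
  · change π (s • p₀) + a₁ (u₁ (w + s • w₀)) + a₂ (u₂ w) = 0
    have e₁ := hval₁ (w + s • w₀)
    rw [hp, QuadraticMap.map_add b, hb, QuadraticMap.map_smul, smul_eq_mul] at e₁
    rw [QuadraticMap.map_smul, h₀, smul_eq_mul]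
    linear_combination e₁ + hval₂ w +
      (s * s * b w₀ + b w - π (p₂ w)) * CharTwo.two_eq_zero (R := F)
  · obtain ⟨⟨hs, h₁⟩, h₂⟩ := by simpa only [Prod.mk_eq_zero] using hv
    obtain rfl : s = 0 := (smul_eq_zero.1 hs).resolve_right hp₀
    rw [zero_smul, add_zero] at h₁ hp
    exact ⟨(hR w).2 ⟨⟨h₁, h₂⟩, hp⟩, rfl⟩

/-- If a totally singular form `b` with the dimension of `π` embeds in `l₁ ⊗ π` and in `l₂ ⊗ π`,
and both `b` and `π` represent `1`, then `l₁ ⊗ l₂ ⊗ π` is isotropic. -/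
lemma isotropic_btensor_btensor {π b : QF F} (hπ : π.PolarNondegenerate)
    (hb : ∀ x y, polar b.form x y = 0) (hdim : π.dim = b.dim)
    (h1π : (unit F).Embeds π) (h1b : (unit F).Embeds b) {l₁ l₂ : List F}
    (h₁ : b.Embeds (btensor l₁ π)) (h₂ : b.Embeds (btensor l₂ π)) :
    (btensor l₁ (btensor l₂ π)).Isotropic := by
  have split : ∀ l, b.Embeds (btensor l π) →
      ∃ f : b.form →qᵢ π.form.prod (bpure l π).form, Function.Injective f := by
    intro l h
    obtain ⟨f, hf⟩ := h.trans (btensor_equiv_sum_bpure l π).embeds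
    exact ⟨(sumIsometry _ _).toIsometry.comp f, (EquivLike.injective (sumIsometry _ _)).comp hf⟩
  obtain ⟨f₁, -⟩ := split l₁ h₁
  obtain ⟨f₂, hf₂⟩ := split l₂ h₂
  obtain ⟨g, hg⟩ := h1π
  obtain ⟨g', -⟩ := h1b
  let e : Fin 1 → F := 1
  have he : e ≠ 0 := one_ne_zero
  obtain ⟨v, hv, hv0⟩ := exists_isotropic_prod_prod hπ.polarBilin_nondegenerate hb
    (by simp [hdim]) f₂ hf₂ f₁ ((g.map_app e).trans (g'.map_app e).symm)
    fun h => he (hg (h.trans (map_zero g).symm))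
  have hiso : ((π.sum (bpure l₂ π)).sum (bpure l₁ π)).Isotropic := by
    let i := (sumIsometry (π.sum (bpure l₂ π)) (bpure l₁ π)).symm
    let j := (sumIsometry π (bpure l₂ π)).symm
    refine ⟨i (j v.1, v.2), ((i.map_app _).trans ?_).trans hv, fun h => hv0 ?_⟩
    · exact congrArg (· + (bpure l₁ π).form v.2) (j.map_app v.1)
    · obtain ⟨h', h''⟩ := Prod.ext_iff.1 (EquivLike.injective i (h.trans (map_zero i).symm))
      exact Prod.ext (EquivLike.injective j (h'.trans (map_zero j).symm)) h''
  refine hiso.of_embeds (((btensor_equiv_sum_bpure l₂ π).symm.embeds.sum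
    ((embeds_btensor l₂ π).bpure l₁)).trans (btensor_equiv_sum_bpure l₁ _).symm.embeds)

lemma IsQPfister.exists_btensor_binary {n : ℕ} {q : QF F} (h : IsQPfister n q) :
    ∃ (l : List F) (α : F), UnitList l ∧ l.length + 1 = n ∧ (btensor l (binary α)).Equiv q := by
  rwa [IsQPfister, if_pos (ringChar.eq F 2)] at h

end CharTwo

end QF

/-- Let `F` be a field of characteristic 2, `ψ₁` an `(m+k)`-fold and
`ψ₂` an `(n+k)`-fold quadratic Pfister form that are separably `k`-linked.  If `ψ₁` and
`ψ₂` are also inseparably `k`-linked, then their `k`-invariant `F_k(ψ₁, ψ₂)` is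
hyperbolic. -/
theorem insep_linked_implies_invariant_hyperbolic
    (F : Type) [Field F] (hchar : ringChar F = 2) (k m n : ℕ)
    (ψ₁ ψ₂ : QF F)
    (h₁ : QF.IsQPfister (m + k) ψ₁) (h₂ : QF.IsQPfister (n + k) ψ₂)
    (hsep : QF.SepLinked k [ψ₁, ψ₂])
    (hinsep : QF.InsepLinked k [ψ₁, ψ₂]) :
    ∀ q, QF.IsPairInv k ψ₁ ψ₂ q → q.Hyperbolic := by
  have : CharP F 2 := ringChar.of_eq hchar
  rintro q ⟨π, l₁, l₂, hπ, hl₁, hl₂, e₁, e₂, eq⟩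
  obtain ⟨b, -, hbk, hb⟩ := hinsep
  obtain ⟨l, α, hl, hlk, eπ⟩ := hπ.exists_btensor_binary
  have hone : ∀ (l : List F) (α : F) (ρ : QF F), (QF.btensor l (QF.binary α)).Equiv ρ →
      (QF.unit F).Embeds ρ := fun l α ρ e =>
    ((QF.unit_embeds_binary α).trans (QF.embeds_btensor l _)).trans e.embeds
  have hemb : ∀ ψ ∈ [ψ₁, ψ₂], (QF.btensor b (QF.unit F)).Embeds ψ := by
    intro ψ hψ
    obtain ⟨j, ρ, hρ, e⟩ := hb ψ hψ
    obtain ⟨l', α', -, -, eρ⟩ := hρ.exists_btensor_binary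
    exact ((hone l' α' ρ eρ).btensor b).trans e.embeds
  have hdim : π.dim = (QF.btensor b (QF.unit F)).dim := by
    rw [← QF.dim_eq_of_equiv eπ, QF.btensor_dim, QF.btensor_dim, hbk, ← hlk, pow_succ]
    exact (mul_one _).symm
  have hiso := QF.isotropic_btensor_btensor
    ((QF.polarNondegenerate_btensor_binary hl α).congr eπ.symm) (QF.polar_btensor_unit b) hdim
    (hone l α π eπ) (QF.embeds_btensor b _)
    ((hemb ψ₁ (by simp)).trans e₁.symm.embeds) ((hemb ψ₂ (by simp)).trans e₂.symm.embeds)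
  have e : q.Equiv (QF.btensor (l₁ ++ (l₂ ++ l)) (QF.binary α)) := by
    rw [QF.btensor_append, QF.btensor_append]
    exact eq.trans ((eπ.symm.btensor l₂).btensor l₁)
  exact ((hiso.of_embeds (eq.symm.trans e).embeds).hyperbolic_btensor_binary
    (hl₁.append (hl₂.append hl))).congr e
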